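/- arXiv:1711.11187 — 3 statements merged into one kernel-verified Lean document; each statement's English description precedes it below -/
import Mathlib

section
/- Let N ≥ 1 and p > 1. Let Γ : ℝ^N × ℝ^N × (0,∞) → ℝ be a measurable nonnegative kernel satisfying ∫_{ℝ^N} Γ(x,y,t) dy = 1 for all x ∈ ℝ^N, t > 0, and the Chapman–Kolmogorov property (K2): Γ(x,y,t) = ∫_{ℝ^N} Γ(x,ξ,t−s) Γ(ξ,y,s) dξ for all x, y ∈ ℝ^N and t > s > 0. Then for every nonnegative φ ∈ L^∞(ℝ^N) there exist T > 0 and a mild solution u of u_t = div(w∇u) + u^p with kernel Γ and initial data φ on ℝ^N × (0,T) satisfying ess sup_{0<t<T} ‖u(·,t)‖_∞ ≤ 2 ‖φ‖_∞. -/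
open MeasureTheory Real Set
open scoped ENNReal

noncomputable section

/-- `N`-dimensional Euclidean space. -/
abbrev E (N : ℕ) : Type := EuclideanSpace ℝ (Fin N)

/-- A mild solution of `u_t = div(w ∇u) + u^p` with kernel `Γ` and initial data `φ`
on `ℝ^N × (0,T)` (`T ∈ (0,∞]`): a nonnegative measurable function, essentially bounded
on `ℝ^N × (0,T)`, satisfying the Duhamel integral identity (with all integrals finite). -/
def IsMildSolution (N : ℕ) (p : ℝ) (Γ : E N → E N → ℝ → ℝ)
    (φ : E N → ℝ) (T : ℝ≥0∞) (u : E N → ℝ → ℝ) : Prop :=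
  Measurable (fun q : E N × ℝ => u q.1 q.2) ∧
  (∀ x t, 0 ≤ u x t) ∧
  (∃ M : ℝ, ∀ t : ℝ, 0 < t → ENNReal.ofReal t < T →
    ∀ᵐ x : E N ∂volume, u x t ≤ M) ∧
  (∀ t : ℝ, 0 < t → ENNReal.ofReal t < T →
    ∀ᵐ x : E N ∂volume,
      Integrable (fun y => Γ x y t * φ y) volume ∧
      Integrable (fun q : E N × ℝ => Γ x q.1 (t - q.2) * u q.1 q.2 ^ p)
        (volume.prod (volume.restrict (Ioo (0:ℝ) t))) ∧
      u x t = (∫ y, Γ x y t * φ y) +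
        ∫ s in Ioo (0:ℝ) t, ∫ y, Γ x y (t - s) * u y s ^ p)

/-- The weak `L^r` quasinorm `‖f‖_{r,∞} = sup_{λ>0} λ |{|f|>λ}|^{1/r}`. -/
def weakNorm (N : ℕ) (r : ℝ) (f : E N → ℝ) : ℝ≥0∞ :=
  ⨆ (l : ℝ) (_ : 0 < l), ENNReal.ofReal l * (volume {x : E N | l < |f x|}) ^ (1 / r)

/-- A Volterra-type equation `v = A + ∫ K v ^ p` in `[0, ∞]` has a measurable solution below any
supersolution `B`. -/
theorem exists_measurable_solution_le_supersolution {α : Type*} [MeasurableSpace α]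
    (μ : Measure α) [SFinite μ] {p : ℝ} (hp : 0 < p) (A B : α → ℝ≥0∞) (K : α → α → ℝ≥0∞)
    (hA : Measurable A) (hK : Measurable (fun z : α × α => K z.1 z.2))
    (hB : ∀ q, A q + ∫⁻ r, K q r * B r ^ p ∂μ ≤ B q) :
    ∃ v : α → ℝ≥0∞, Measurable v ∧ (∀ q, v q ≤ B q) ∧
      ∀ q, v q = A q + ∫⁻ r, K q r * v r ^ p ∂μ := by
  let F : (α → ℝ≥0∞) → (α → ℝ≥0∞) := fun v q => A q + ∫⁻ r, K q r * v r ^ p ∂μ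
  have hFmono : Monotone F := by
    intro v w hvw q
    dsimp only [F]
    gcongr
    exact hvw _
  have hFmeas : ∀ v, Measurable v → Measurable (F v) := by
    intro v hv
    refine hA.add (Measurable.lintegral_prod_right' (f := fun z : α × α => K z.1 z.2 * v z.2 ^ p) ?_)
    exact hK.mul ((hv.comp measurable_snd).pow_const p)
  let w : ℕ → α → ℝ≥0∞ := fun n => F^[n] 0
  have hwsucc : ∀ n, w (n + 1) = F (w n) := fun n => Function.iterate_succ_apply' F n 0
  have hwmeas : ∀ n, Measurable (w n) := by
    intro n
    induction n with
    | zero => exact measurable_const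
    | succ n ih => rw [hwsucc]; exact hFmeas _ ih
  have hwmono : Monotone w := hFmono.monotone_iterate_of_le_map (fun _ => zero_le)
  have hwB : ∀ n, w n ≤ B := by
    intro n
    induction n with
    | zero => exact fun _ => zero_le
    | succ n ih => rw [hwsucc]; exact (hFmono ih).trans hB
  have hsup : ∀ q, ⨆ n, w n q = ⨆ n, w (n + 1) q := fun q =>
    (Monotone.iSup_nat_add (f := fun n => w n q) (fun _ _ h => hwmono h q) 1).symm
  refine ⟨fun q => ⨆ n, w n q, Measurable.iSup hwmeas, fun q => iSup_le fun n => hwB n q, ?_⟩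
  intro q
  have hint : ∫⁻ r, K q r * (⨆ n, w n r) ^ p ∂μ = ⨆ n, ∫⁻ r, K q r * w n r ^ p ∂μ := by
    rw [← lintegral_iSup]
    · refine lintegral_congr fun r => ?_
      rw [← ENNReal.mul_iSup]
      congr 1
      exact (ENNReal.orderIsoRpow p hp).map_iSup _
    · exact fun n => (hK.comp measurable_prodMk_left).mul ((hwmeas n).pow_const p)
    · intro m n h r
      dsimp only
      gcongr
      exact hwmono h r
  dsimp only
  rw [hint, ENNReal.add_iSup, hsup]
  exact iSup_congr fun n => congrFun (hwsucc n) q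

/-- A Bochner integral of a nonnegative function equal to `1` is a lower integral equal to `1`. -/
theorem lintegral_ofReal_eq_one {α : Type*} [MeasurableSpace α] {μ : Measure α} {f : α → ℝ}
    (hf : ∀ x, 0 ≤ f x) (h : ∫ x, f x ∂μ = 1) : ∫⁻ x, ENNReal.ofReal (f x) ∂μ = 1 := by
  have hi : Integrable f μ := by
    by_contra hc
    rw [integral_undef hc] at h
    exact zero_ne_one h
  rw [← ofReal_integral_eq_lintegral_ofReal hi (Filter.Eventually.of_forall hf), h,
    ENNReal.ofReal_one]

/-- A nonnegative real-valued function with finite lower integral is integrable, and its integral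
is the real part of the lower integral. -/
theorem integrable_and_integral_eq_toReal {α : Type*} [MeasurableSpace α] {μ : Measure α}
    {f : α → ℝ} {g : α → ℝ≥0∞} (hf : AEStronglyMeasurable f μ) (hf0 : 0 ≤ᵐ[μ] f)
    (hfg : ∀ᵐ x ∂μ, ENNReal.ofReal (f x) = g x) (hg : ∫⁻ x, g x ∂μ ≠ ⊤) :
    Integrable f μ ∧ ∫ x, f x ∂μ = (∫⁻ x, g x ∂μ).toReal := by
  rw [← lintegral_congr_ae hfg] at hg ⊢
  exact ⟨(lintegral_ofReal_ne_top_iff_integrable hf hf0).1 hg,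
    integral_eq_lintegral_of_nonneg_ae hf0 hf⟩

/-- For every size `m` there is a time `T > 0` with `T (2m)^p ≤ m`. -/
theorem exists_time_mul_rpow_le {p m : ℝ} (hp : 0 < p) (hm : 0 ≤ m) :
    ∃ T : ℝ, 0 < T ∧ T * (2 * m) ^ p ≤ m := by
  rcases hm.eq_or_lt with rfl | hm
  · exact ⟨1, one_pos, by simp [Real.zero_rpow hp.ne']⟩
  · have h : 0 < (2 * m) ^ p := by positivity
    exact ⟨m / (2 * m) ^ p, by positivity, by rw [div_mul_cancel₀ _ h.ne']⟩

/-- Lemma 4.2 (local-in-time existence): for any nonnegative `φ ∈ L^∞` there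
exist `T > 0` and a mild solution `u` on `ℝ^N × (0,T)` with
`ess sup_{0<t<T} ‖u(t)‖_∞ ≤ 2 ‖φ‖_∞`. -/
theorem local_existence (N : ℕ) (hN : 1 ≤ N) (p : ℝ) (hp : 1 < p)
    (Γ : E N → E N → ℝ → ℝ)
    (hΓmeas : Measurable (fun q : E N × E N × ℝ => Γ q.1 q.2.1 q.2.2))
    (hΓnonneg : ∀ x y : E N, ∀ t : ℝ, 0 < t → 0 ≤ Γ x y t)
    (hK1y : ∀ x : E N, ∀ t : ℝ, 0 < t → ∫ y : E N, Γ x y t = 1)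
    (hK2 : ∀ x y : E N, ∀ s t : ℝ, 0 < s → s < t →
      Γ x y t = ∫ ξ : E N, Γ x ξ (t - s) * Γ ξ y s)
    (φ : E N → ℝ) (hφmeas : Measurable φ) (hφnonneg : ∀ x, 0 ≤ φ x)
    (hφbdd : eLpNorm φ ⊤ volume ≠ ⊤) :
    ∃ T : ℝ, 0 < T ∧ ∃ u : E N → ℝ → ℝ,
      IsMildSolution N p Γ φ (ENNReal.ofReal T) u ∧
      ∀ t : ℝ, 0 < t → t < T →
        eLpNorm (fun x => u x t) ⊤ volume ≤ 2 * eLpNorm φ ⊤ volume := by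
  have hp0 : 0 < p := by linarith
  set M := eLpNorm φ ⊤ volume with hM
  obtain ⟨T, hT, hTM⟩ := exists_time_mul_rpow_le hp0 (ENNReal.toReal_nonneg (a := M))
  set b : ℝ≥0∞ := 2 * M with hb
  have hbtop : b ≠ ⊤ := ENNReal.mul_ne_top (by simp) hφbdd
  have hTb : ENNReal.ofReal T * b ^ p ≤ M := by
    have hbr : b = ENNReal.ofReal (2 * M.toReal) := by
      rw [ENNReal.ofReal_mul zero_le_two, ENNReal.ofReal_toReal hφbdd]
      simp [hb]
    rw [hbr, ENNReal.ofReal_rpow_of_nonneg (by positivity) hp0.le, ← ENNReal.ofReal_mul hT.le]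
    exact (ENNReal.ofReal_le_ofReal hTM).trans ENNReal.ofReal_toReal_le
  have hφM : ∀ᵐ y : E N ∂volume, ENNReal.ofReal (φ y) ≤ M := by
    filter_upwards [ae_le_eLpNormEssSup (f := φ) (μ := volume)] with y hy
    rw [hM, eLpNorm_exponent_top]
    rwa [Real.enorm_eq_ofReal (hφnonneg y)] at hy
  have hmass : ∀ x t, 0 < t → ∫⁻ y : E N, ENNReal.ofReal (Γ x y t) = 1 := fun x t ht =>
    lintegral_ofReal_eq_one (fun y => hΓnonneg x y t ht) (hK1y x t ht)
  let A : E N × ℝ → ℝ≥0∞ := fun q =>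
    ∫⁻ y, ENNReal.ofReal (Γ q.1 y q.2) * ENNReal.ofReal (φ y)
  let K : E N × ℝ → E N × ℝ → ℝ≥0∞ := fun q r =>
    if 0 < r.2 ∧ r.2 < q.2 then ENNReal.ofReal (Γ q.1 r.1 (q.2 - r.2)) else 0
  let B : E N × ℝ → ℝ≥0∞ := fun q => if 0 < q.2 ∧ q.2 < T then b else ⊤
  have hAmeas : Measurable A := by
    refine Measurable.lintegral_prod_right'
      (f := fun z : (E N × ℝ) × E N => ENNReal.ofReal (Γ z.1.1 z.2 z.1.2) * ENNReal.ofReal (φ z.2)) ?_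
    refine Measurable.mul ?_ (hφmeas.comp measurable_snd).ennreal_ofReal
    exact (hΓmeas.comp (g := fun q : E N × E N × ℝ => Γ q.1 q.2.1 q.2.2)
      (f := fun z : (E N × ℝ) × E N => (z.1.1, z.2, z.1.2)) (by fun_prop)).ennreal_ofReal
  have hKmeas : Measurable (fun z : (E N × ℝ) × (E N × ℝ) => K z.1 z.2) := by
    refine Measurable.ite ?_ ?_ measurable_const
    · exact (measurableSet_lt measurable_const measurable_snd.snd).inter
        (measurableSet_lt measurable_snd.snd measurable_fst.snd)
    · exact (hΓmeas.comp (g := fun q : E N × E N × ℝ => Γ q.1 q.2.1 q.2.2)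
        (f := fun z : (E N × ℝ) × (E N × ℝ) => (z.1.1, z.2.1, z.1.2 - z.2.2))
        (by fun_prop)).ennreal_ofReal
  have hAM : ∀ x t, 0 < t → A (x, t) ≤ M := by
    intro x t ht
    calc A (x, t) ≤ ∫⁻ y, ENNReal.ofReal (Γ x y t) * M :=
          lintegral_mono_ae (hφM.mono fun y hy => by dsimp only; gcongr)
      _ = M := by rw [lintegral_mul_const' _ _ hφbdd, hmass x t ht, one_mul]
  have hKint : ∀ (x : E N) (t : ℝ) (g : E N × ℝ → ℝ≥0∞),
      ∫⁻ r, K (x, t) r * g r = ∫⁻ r, ENNReal.ofReal (Γ x r.1 (t - r.2)) * g r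
        ∂((volume : Measure (E N)).prod (volume.restrict (Ioo (0 : ℝ) t))) := by
    intro x t g
    have hprod : (volume : Measure (E N)).prod (volume.restrict (Ioo (0 : ℝ) t)) =
        (volume : Measure (E N × ℝ)).restrict (univ ×ˢ Ioo 0 t) := by
      rw [Measure.volume_eq_prod, ← Measure.prod_restrict, Measure.restrict_univ]
    rw [hprod, ← lintegral_indicator (MeasurableSet.univ.prod measurableSet_Ioo)]
    refine lintegral_congr fun r => ?_
    by_cases hr : 0 < r.2 ∧ r.2 < t <;> simp [K, indicator, hr]
  have hΓslice : ∀ x t, Measurable (fun r : E N × ℝ => Γ x r.1 (t - r.2)) := fun x t =>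
    hΓmeas.comp (g := fun q : E N × E N × ℝ => Γ q.1 q.2.1 q.2.2)
      (f := fun r : E N × ℝ => (x, r.1, t - r.2)) (by fun_prop)
  have hsuper : ∀ q, A q + ∫⁻ r, K q r * B r ^ p ≤ B q := by
    rintro ⟨x, t⟩
    by_cases ht : 0 < t ∧ t < T
    · have hK : ∫⁻ r, K (x, t) r * B r ^ p ≤ M := by
        calc ∫⁻ r, K (x, t) r * B r ^ p = ∫⁻ r, K (x, t) r * b ^ p := by
              refine lintegral_congr fun r => ?_
              by_cases hr : 0 < r.2 ∧ r.2 < t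
              · simp [B, hr.1, hr.2.trans ht.2]
              · simp [K, hr]
          _ = (∫⁻ s in Ioo (0 : ℝ) t, 1) * b ^ p := by
              rw [hKint, lintegral_mul_const' _ _ (ENNReal.rpow_ne_top_of_nonneg hp0.le hbtop),
                lintegral_prod_symm' _ (hΓslice x t).ennreal_ofReal]
              congr 1
              refine setLIntegral_congr_fun measurableSet_Ioo fun s hs => ?_
              exact hmass x (t - s) (sub_pos.2 hs.2)
          _ = ENNReal.ofReal t * b ^ p := by simp
          _ ≤ ENNReal.ofReal T * b ^ p := by gcongr; exact ht.2.le
          _ ≤ M := hTb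
      have hBb : B (x, t) = M + M := by simp [B, ht, hb, two_mul]
      rw [hBb]
      exact add_le_add (hAM x t ht.1) hK
    · simp [B, ht]
  obtain ⟨v, hvmeas, hvB, hv⟩ :=
    exists_measurable_solution_le_supersolution volume hp0 A B K hAmeas hKmeas hsuper
  have hvb : ∀ x t, 0 < t → t < T → v (x, t) ≤ b := fun x t h0 h1 => by
    simpa [B, h0, h1] using hvB (x, t)
  have hvtop : ∀ x t, 0 < t → t < T → v (x, t) ≠ ⊤ := fun x t h0 h1 =>
    ne_top_of_le_ne_top hbtop (hvb x t h0 h1)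
  let u : E N → ℝ → ℝ := fun x t => (v (x, t)).toReal
  have humeas : Measurable (fun q : E N × ℝ => u q.1 q.2) := hvmeas.ennreal_toReal
  refine ⟨T, hT, u, ⟨humeas, fun _ _ => ENNReal.toReal_nonneg, ⟨b.toReal, ?_⟩, ?_⟩, ?_⟩
  · intro t h0 h1
    exact Filter.Eventually.of_forall fun x =>
      ENNReal.toReal_mono hbtop (hvb x t h0 ((ENNReal.ofReal_lt_ofReal_iff hT).1 h1))
  · intro t h0 h1
    replace h1 : t < T := (ENNReal.ofReal_lt_ofReal_iff hT).1 h1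
    refine Filter.Eventually.of_forall fun x => ?_
    have hvx : v (x, t) = A (x, t) + ∫⁻ r, ENNReal.ofReal (Γ x r.1 (t - r.2)) * v r ^ p
        ∂((volume : Measure (E N)).prod (volume.restrict (Ioo (0 : ℝ) t))) := by
      rw [hv, hKint]
    have hfin := hvtop x t h0 h1
    rw [hvx, ENNReal.add_ne_top] at hfin
    have hIoo : ∀ᵐ r ∂((volume : Measure (E N)).prod (volume.restrict (Ioo (0 : ℝ) t))),
        r.2 ∈ Ioo (0 : ℝ) t :=
      Measure.quasiMeasurePreserving_snd.ae (ae_restrict_mem measurableSet_Ioo)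
    obtain ⟨hi₁, he₁⟩ := integrable_and_integral_eq_toReal
      (f := fun y => Γ x y t * φ y) (μ := (volume : Measure (E N)))
      (((hΓmeas.comp (g := fun q : E N × E N × ℝ => Γ q.1 q.2.1 q.2.2)
        (f := fun y : E N => (x, y, t)) (by fun_prop)).mul hφmeas).aestronglyMeasurable)
      (Filter.Eventually.of_forall fun y => mul_nonneg (hΓnonneg x y t h0) (hφnonneg y))
      (Filter.Eventually.of_forall fun y => ENNReal.ofReal_mul (hΓnonneg x y t h0)) hfin.1
    obtain ⟨hi₂, he₂⟩ := integrable_and_integral_eq_toReal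
      (f := fun q : E N × ℝ => Γ x q.1 (t - q.2) * u q.1 q.2 ^ p)
      (μ := (volume : Measure (E N)).prod (volume.restrict (Ioo (0 : ℝ) t)))
      ((hΓslice x t).mul (humeas.pow_const p)).aestronglyMeasurable
      (hIoo.mono fun r hr => mul_nonneg (hΓnonneg _ _ _ (sub_pos.2 hr.2))
        (Real.rpow_nonneg ENNReal.toReal_nonneg p))
      (hIoo.mono fun r hr => by
        rw [ENNReal.ofReal_mul (hΓnonneg _ _ _ (sub_pos.2 hr.2)),
          ← ENNReal.ofReal_rpow_of_nonneg ENNReal.toReal_nonneg hp0.le,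
          ENNReal.ofReal_toReal (hvtop r.1 r.2 hr.1 (hr.2.trans h1))]) hfin.2
    refine ⟨hi₁, hi₂, ?_⟩
    rw [he₁, ← integral_prod_symm _ hi₂, he₂, ← ENNReal.toReal_add hfin.1 hfin.2]
    exact congrArg ENNReal.toReal hvx
  · intro t h0 h1
    rw [eLpNorm_exponent_top]
    refine essSup_le_of_ae_le _ (Filter.Eventually.of_forall fun x => ?_)
    change ‖(v (x, t)).toReal‖ₑ ≤ b
    rw [Real.enorm_eq_ofReal ENNReal.toReal_nonneg, ENNReal.ofReal_toReal (hvtop x t h0 h1)]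
    exact hvb x t h0 h1
end
end

section
/- Let N ≥ 1 and let a be a real number with −1 < a < 1 and aN < 2. Set μ := 1 − max(a,0)/2, and note μ > 1/2. Then there exists a constant C > 0 such that for every x ∈ ℝ^N, every R > 0, and every s ≥ 1, ∫_{B_{sR}(x)} |y₁|^{−aN/2} dy ≥ C s^{μN} ∫_{B_R(x)} |y₁|^{−aN/2} dy, where y₁ denotes the first coordinate of y. That is, the function w^{−N/2} with w(y) = |y₁|^a satisfies a reverse doubling condition of order μ with μ > 1/2. -/
open MeasureTheory Real Set
open scoped ENNReal

open Metric in
/-- A locally integrable function of one coordinate is integrable on Euclidean balls. -/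
lemma integrableOn_ball_comp_coord {ι : Type*} [Fintype ι] (i : ι) {f : ℝ → ℝ}
    (hf : LocallyIntegrable f) (x : EuclideanSpace ℝ ι) (r : ℝ) :
    IntegrableOn (fun y : EuclideanSpace ℝ ι ↦ f (y i)) (ball x r) := by
  classical
  set M : ℝ := ‖x‖ + r
  have hpi : IntegrableOn (fun y : ι → ℝ ↦ f (y i)) (univ.pi fun _ ↦ Icc (-M) M) := by
    have h := Integrable.fintype_prod (f := fun j ↦ if j = i then f else fun _ ↦ (1 : ℝ))
      (μ := fun _ ↦ volume.restrict (Icc (-M) M)) (fun j ↦ by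
        split_ifs
        · exact hf.integrableOn_isCompact isCompact_Icc
        · exact integrable_const 1)
    rw [IntegrableOn, volume_pi, Measure.restrict_pi_pi]
    refine h.congr (.of_forall fun y ↦ ?_)
    beta_reduce
    rw [Finset.prod_eq_single i] <;> simp +contextual
  have hmp := (PiLp.volume_preserving_ofLp ι).integrableOn_comp_preimage
    (MeasurableEquiv.toLp 2 (ι → ℝ)).symm.measurableEmbedding
    |>.2 hpi
  refine hmp.mono_set fun y hy ↦ ?_
  simp only [mem_preimage, mem_pi, mem_univ, true_imp_iff]
  intro j
  have h1 : ‖y j‖ ≤ ‖y‖ := PiLp.norm_apply_le y j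
  have h2 : ‖y‖ ≤ ‖x‖ + ‖y - x‖ := by simpa using norm_add_le x (y - x)
  have h3 := mem_ball_iff_norm.1 hy
  exact abs_le.1 (h1.trans (h2.trans (by simp only [M]; linarith)))

lemma locallyIntegrable_abs_rpow {β : ℝ} (hβ : -1 < β) :
    LocallyIntegrable fun t : ℝ ↦ |t| ^ β := by
  refine locallyIntegrable_of_norm_le_rpow (C := 1) (α := -β) (by simp) (by simp; linarith)
    (.of_forall fun t ↦ ?_)
    (by fun_prop : Measurable fun t : ℝ ↦ |t| ^ β).aestronglyMeasurable
  rw [neg_neg, one_mul, Real.norm_of_nonneg (by positivity), Real.norm_eq_abs]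

lemma integrableOn_ball_abs_add_rpow {ι : Type*} [Fintype ι] (i : ι) {β : ℝ} (hβ : -1 < β)
    (c r : ℝ) :
    IntegrableOn (fun u : EuclideanSpace ℝ ι ↦ |c + u i| ^ β) (Metric.ball 0 r) := by
  classical
  have h := (measurePreserving_add_left volume (EuclideanSpace.single i c)).integrableOn_comp_preimage
    (measurableEmbedding_addLeft _) |>.2
    (integrableOn_ball_comp_coord i (locallyIntegrable_abs_rpow hβ) (EuclideanSpace.single i c) r)
  simpa [Function.comp_def] using h

/-- The integral of `|y i| ^ β` over a ball, reduced to the unit ball. -/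
lemma setIntegral_ball_abs_rpow {N : ℕ} (i : Fin N) (β : ℝ) (x : EuclideanSpace ℝ (Fin N))
    {R : ℝ} (hR : 0 < R) :
    ∫ y in Metric.ball x R, |y i| ^ β =
      R ^ (N + β) * ∫ u : EuclideanSpace ℝ (Fin N) in Metric.ball 0 1, |R⁻¹ * x i + u i| ^ β := by
  have htrans := (measurePreserving_add_left volume x).setIntegral_preimage_emb
    (measurableEmbedding_addLeft x) (fun y : EuclideanSpace ℝ (Fin N) ↦ |y i| ^ β) (Metric.ball x R)
  have hscale := Measure.setIntegral_comp_smul_of_pos volume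
    (fun u : EuclideanSpace ℝ (Fin N) ↦ |x i + u i| ^ β) (Metric.ball 0 1) hR
  rw [smul_unitBall_of_pos hR] at hscale
  have hpt (u : EuclideanSpace ℝ (Fin N)) :
      |x i + (R • u) i| ^ β = R ^ β * |R⁻¹ * x i + u i| ^ β := by
    rw [← Real.mul_rpow hR.le (abs_nonneg _), ← abs_of_pos hR, ← abs_mul, abs_of_pos hR]
    congr 2
    simp only [PiLp.smul_apply, smul_eq_mul]
    field_simp
  simp only [hpt, integral_const_mul, finrank_euclideanSpace, Fintype.card_fin, smul_eq_mul]
    at hscale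
  rw [← htrans]
  simp only [preimage_add_ball, sub_self, PiLp.add_apply]
  rw [Real.rpow_add hR, Real.rpow_natCast, mul_assoc, hscale]
  field_simp

lemma abs_apply_lt_of_mem_ball_zero {ι : Type*} [Fintype ι] {i : ι} {r : ℝ}
    {u : EuclideanSpace ℝ ι} (hu : u ∈ Metric.ball 0 r) : |u i| < r :=
  (PiLp.norm_apply_le u i).trans_lt (mem_ball_zero_iff.1 hu)

lemma volume_unitBall_real_pos (ι : Type*) [Fintype ι] :
    0 < volume.real (Metric.ball (0 : EuclideanSpace ℝ ι) 1) :=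
  ENNReal.toReal_pos (Metric.measure_ball_pos _ _ one_pos).ne' measure_ball_lt_top.ne

/-- For nonpositive exponents the integral of `|c + u i| ^ β` over the unit ball is, up to a
constant, largest for small `c`. -/
lemma exists_mul_integral_le_of_nonpos {ι : Type*} [Fintype ι] (i : ι) {β : ℝ} (hβ : -1 < β)
    (hβ' : β ≤ 0) :
    ∃ C : ℝ, 0 < C ∧ ∀ c s : ℝ, 1 ≤ s →
      C * ∫ u : EuclideanSpace ℝ ι in Metric.ball 0 1, |c + u i| ^ β ≤
        ∫ u : EuclideanSpace ℝ ι in Metric.ball 0 1, |s⁻¹ * c + u i| ^ β := by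
  classical
  set G : ℝ → ℝ := fun c ↦ ∫ u : EuclideanSpace ℝ ι in Metric.ball 0 1, |c + u i| ^ β with hG
  set V := volume.real (Metric.ball (0 : EuclideanSpace ℝ ι) 1) with hV
  have hVpos : 0 < V := volume_unitBall_real_pos ι
  have hfin : volume (Metric.ball (0 : EuclideanSpace ℝ ι) 1) ≠ ∞ := measure_ball_lt_top.ne
  have hlow (c : ℝ) : (|c| + 1) ^ β * V ≤ G c := by
    have hne : ∀ᵐ u : EuclideanSpace ℝ ι, u i ≠ -c :=
      (PiLp.volume_preserving_ofLp ι).quasiMeasurePreserving.ae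
        (Measure.ae_eval_ne (fun _ ↦ volume) i (-c))
    rw [mul_comm, ← smul_eq_mul, ← setIntegral_const]
    refine setIntegral_mono_on_ae (integrableOn_const hfin)
      (integrableOn_ball_abs_add_rpow i hβ c 1) measurableSet_ball ?_
    filter_upwards [hne] with u hu hub
    refine Real.rpow_le_rpow_of_nonpos (abs_pos.2 fun h ↦ hu (by linarith)) ?_ hβ'
    exact (abs_add_le _ _).trans (by gcongr; exact (abs_apply_lt_of_mem_ball_zero hub).le)
  have hfar {c : ℝ} (hc : 2 < |c|) : G c ≤ (|c| / 2) ^ β * V := by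
    rw [mul_comm, ← smul_eq_mul, ← setIntegral_const]
    refine setIntegral_mono_on (integrableOn_ball_abs_add_rpow i hβ c 1)
      (integrableOn_const hfin) measurableSet_ball fun u hu ↦ ?_
    refine Real.rpow_le_rpow_of_nonpos (by linarith) ?_ hβ'
    have h1 := abs_apply_lt_of_mem_ball_zero (i := i) hu
    have h2 := abs_sub_abs_le_abs_add c (u i)
    linarith
  set K := ∫ y in Metric.ball (0 : EuclideanSpace ℝ ι) 3, |y i| ^ β with hK
  have hnear {c : ℝ} (hc : |c| ≤ 2) : G c ≤ K := by
    have htrans := (measurePreserving_add_left volume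
      (EuclideanSpace.single i c)).setIntegral_preimage_emb
      (measurableEmbedding_addLeft _) (fun y : EuclideanSpace ℝ ι ↦ |y i| ^ β)
      (Metric.ball (EuclideanSpace.single i c) 1)
    simp only [preimage_add_ball, sub_self, PiLp.add_apply, PiLp.single_apply,
      if_true] at htrans
    rw [hG, hK]
    simp only [htrans]
    refine setIntegral_mono_set
      (integrableOn_ball_comp_coord i (locallyIntegrable_abs_rpow hβ) 0 3)
      (.of_forall fun y ↦ by positivity)
      (Metric.ball_subset_ball' ?_).eventuallyLE
    simp only [dist_zero_right, PiLp.norm_single, Real.norm_eq_abs]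
    linarith
  have hGpos (c : ℝ) : 0 < G c := lt_of_lt_of_le (by positivity) (hlow c)
  have hKpos : 0 < K := (hGpos 0).trans_le (hnear (by simp))
  refine ⟨3 ^ β * min 1 (V / K), by positivity, fun c s hs ↦ ?_⟩
  change 3 ^ β * min 1 (V / K) * G c ≤ G (s⁻¹ * c)
  have hsc : |s⁻¹ * c| ≤ |c| := by
    rw [abs_mul, abs_of_pos (by positivity : 0 < s⁻¹)]
    exact mul_le_of_le_one_left (abs_nonneg _) (inv_le_one_of_one_le₀ hs)
  have hmono : (|c| + 1) ^ β * V ≤ G (s⁻¹ * c) := by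
    refine le_trans ?_ (hlow _)
    gcongr ?_ * V
    exact Real.rpow_le_rpow_of_nonpos (by positivity) (by linarith) hβ'
  refine le_trans ?_ hmono
  rcases le_or_gt |c| 2 with hc | hc
  · calc 3 ^ β * min 1 (V / K) * G c ≤ 3 ^ β * (V / K) * K := by
          gcongr
          · exact min_le_right _ _
          · exact hnear hc
      _ = 3 ^ β * V := by field_simp
      _ ≤ (|c| + 1) ^ β * V := by
          gcongr ?_ * V
          exact Real.rpow_le_rpow_of_nonpos (by positivity) (by linarith) hβ'
  · calc 3 ^ β * min 1 (V / K) * G c ≤ 3 ^ β * 1 * ((|c| / 2) ^ β * V) := by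
          gcongr
          · exact min_le_left _ _
          · exact hfar hc
      _ = (3 * (|c| / 2)) ^ β * V := by
          rw [Real.mul_rpow (by norm_num) (by positivity)]; ring
      _ ≤ (|c| + 1) ^ β * V := by
          gcongr ?_ * V
          exact Real.rpow_le_rpow_of_nonpos (by positivity) (by linarith) hβ'

lemma abs_add_rpow_le_symm {β : ℝ} (hβ : 0 ≤ β) {s : ℝ} (hs : 1 ≤ s) (c t : ℝ) :
    |c + t| ^ β ≤ 2 ^ β * (|c + s * t| ^ β + |c - s * t| ^ β) := by
  have hst : |t| ≤ |s * t| := by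
    rw [abs_mul, abs_of_pos (by linarith : 0 < s)]
    exact le_mul_of_one_le_left (abs_nonneg _) hs
  have key : |c + t| ≤ 2 * max |c + s * t| |c - s * t| := by
    have h1 := le_max_left |c + s * t| |c - s * t|
    have h2 := le_max_right |c + s * t| |c - s * t|
    have h3 := abs_add_le c t
    have h4 : |c| + |s * t| ≤ 2 * max |c + s * t| |c - s * t| := by
      rcases abs_cases c with h | h <;> rcases abs_cases (s * t) with h' | h' <;>
        rcases abs_le.1 h1 with ⟨_, _⟩ <;> rcases abs_le.1 h2 with ⟨_, _⟩ <;> linarith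
    linarith
  calc |c + t| ^ β ≤ (2 * max |c + s * t| |c - s * t|) ^ β := by gcongr
    _ = 2 ^ β * (max |c + s * t| |c - s * t|) ^ β :=
        Real.mul_rpow (by norm_num) (by positivity)
    _ ≤ _ := by
        gcongr
        have := Real.rpow_nonneg (abs_nonneg (c + s * t)) β
        have := Real.rpow_nonneg (abs_nonneg (c - s * t)) β
        rcases max_choice |c + s * t| |c - s * t| with h | h <;> rw [h] <;> linarith

/-- For nonnegative exponents, dilating `u i` inside `|c + u i| ^ β` does not decrease the integral
over the unit ball, up to a constant. -/
lemma mul_integral_le_of_nonneg {ι : Type*} [Fintype ι] (i : ι) {β : ℝ} (hβ : 0 ≤ β)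
    (c : ℝ) {s : ℝ} (hs : 1 ≤ s) :
    (2 * 2 ^ β)⁻¹ * ∫ u : EuclideanSpace ℝ ι in Metric.ball 0 1, |c + u i| ^ β ≤
      s ^ β * ∫ u : EuclideanSpace ℝ ι in Metric.ball 0 1, |s⁻¹ * c + u i| ^ β := by
  have hs0 : 0 < s := by linarith
  have hβ1 : -1 < β := by linarith
  have hpt (t : ℝ) : |c + s * t| ^ β = s ^ β * |s⁻¹ * c + t| ^ β := by
    rw [← Real.mul_rpow hs0.le (abs_nonneg _), ← abs_of_pos hs0, ← abs_mul, abs_of_pos hs0]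
    congr 2
    field_simp
  have hint : IntegrableOn (fun u : EuclideanSpace ℝ ι ↦ |c + s * u i| ^ β) (Metric.ball 0 1) := by
    simp only [hpt]
    exact (integrableOn_ball_abs_add_rpow i hβ1 _ 1).const_mul _
  have hneg := (Measure.measurePreserving_neg
    (volume : Measure (EuclideanSpace ℝ ι))).setIntegral_preimage_emb
    (MeasurableEquiv.neg _).measurableEmbedding
    (fun u : EuclideanSpace ℝ ι ↦ |c + s * u i| ^ β) (Metric.ball 0 1)
  have hintneg := ((Measure.measurePreserving_neg
    (volume : Measure (EuclideanSpace ℝ ι))).integrableOn_comp_preimage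
    (MeasurableEquiv.neg _).measurableEmbedding).2 hint
  have hball : Neg.neg ⁻¹' Metric.ball (0 : EuclideanSpace ℝ ι) 1 = Metric.ball 0 1 := by
    ext; simp
  rw [hball] at hneg hintneg
  simp only [Function.comp_def, PiLp.neg_apply, mul_neg, ← sub_eq_add_neg] at hneg hintneg
  rw [← integral_const_mul (s ^ β)]
  simp only [← hpt]
  rw [inv_mul_le_iff₀ (by positivity)]
  calc _ ≤ ∫ u : EuclideanSpace ℝ ι in Metric.ball 0 1,
        2 ^ β * (|c + s * u i| ^ β + |c - s * u i| ^ β) :=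
        setIntegral_mono (integrableOn_ball_abs_add_rpow i hβ1 c 1)
          ((hint.add hintneg).const_mul _) fun u ↦ abs_add_rpow_le_symm hβ hs c (u i)
    _ = _ := by
        rw [integral_const_mul, integral_add hint hintneg, hneg]; ring

/-- Reverse doubling of order `μ = 1 - max(a,0)/2 > 1/2` for `w^{-N/2}` with
`w(y) = |y₁|^a`, `-1 < a < 1`, `aN < 2`. -/
theorem reverse_doubling_line_weight
    (N : ℕ) (hN : 1 ≤ N) (a : ℝ) (ha1 : -1 < a) (ha2 : a < 1) (haN : a * N < 2)
    (μ : ℝ) (hμ : μ = 1 - max a 0 / 2) :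
    1 / 2 < μ ∧
    ∃ C : ℝ, 0 < C ∧ ∀ x : EuclideanSpace ℝ (Fin N), ∀ R s : ℝ, 0 < R → 1 ≤ s →
      C * s ^ (μ * N) * ∫ y in Metric.ball x R, |y ⟨0, hN⟩| ^ (-(a * N) / 2) ≤
        ∫ y in Metric.ball x (s * R), |y ⟨0, hN⟩| ^ (-(a * N) / 2) := by
  have hmax : max a 0 < 1 := max_lt ha2 one_pos
  refine ⟨by linarith, ?_⟩
  set β := -(a * N) / 2 with hβ
  have hβ1 : -1 < β := by linarith
  obtain ⟨γ, C, hC, hγ, h⟩ : ∃ γ C : ℝ, 0 < C ∧ N + β = μ * N + γ ∧ ∀ c s : ℝ, 1 ≤ s →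
      C * ∫ u : EuclideanSpace ℝ (Fin N) in Metric.ball 0 1, |c + u ⟨0, hN⟩| ^ β ≤
        s ^ γ * ∫ u : EuclideanSpace ℝ (Fin N) in Metric.ball 0 1,
          |s⁻¹ * c + u ⟨0, hN⟩| ^ β := by
    rcases le_total 0 a with ha | ha
    · have hβ0 : β ≤ 0 := by
        have : 0 ≤ a * N := by positivity
        linarith
      obtain ⟨C, hC, h⟩ := exists_mul_integral_le_of_nonpos (⟨0, hN⟩ : Fin N) hβ1 hβ0
      refine ⟨0, C, hC, ?_, by simpa using h⟩
      rw [hμ, max_eq_left ha, hβ]; ring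
    · have hβ0 : 0 ≤ β := by
        have : a * N ≤ 0 := mul_nonpos_of_nonpos_of_nonneg ha (by positivity)
        linarith
      refine ⟨β, (2 * 2 ^ β)⁻¹, by positivity, ?_, fun c s hs ↦
        mul_integral_le_of_nonneg _ hβ0 c hs⟩
      rw [hμ, max_eq_right ha]; ring
  refine ⟨C, hC, fun x R s hR hs ↦ ?_⟩
  have hs0 : 0 < s := by linarith
  rw [setIntegral_ball_abs_rpow _ _ _ hR, setIntegral_ball_abs_rpow _ _ _ (mul_pos hs0 hR),
    Real.mul_rpow hs0.le hR.le, mul_inv, mul_assoc s⁻¹]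
  nth_rewrite 2 [hγ]
  rw [Real.rpow_add hs0]
  have key := mul_le_mul_of_nonneg_left (h (R⁻¹ * x ⟨0, hN⟩) s hs)
    (by positivity : 0 ≤ s ^ (μ * N) * R ^ (N + β))
  linarith
end

section
/- Let N ≥ 1 and let b be a real number with −N < b < 1. Set μ := 1 − max(b,0)/2, and note μ > 1/2. Then there exists a constant C > 0 such that for every x ∈ ℝ^N, every R > 0, and every s ≥ 1, ∫_{B_{sR}(x)} |y|^{−bN/2} dy ≥ C s^{μN} ∫_{B_R(x)} |y|^{−bN/2} dy. That is, the function w^{−N/2} with w(y) = |y|^b satisfies a reverse doubling condition of order μ with μ > 1/2. -/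
open MeasureTheory Real Set
open scoped ENNReal

section RadialPowerWeight

open Module Metric

lemma rpow_le_rpow_abs_mul_of_div_le {k M t : ℝ} (α : ℝ) (hk : 1 ≤ k) (hM : 0 < M)
    (h₁ : M / k ≤ t) (h₂ : t ≤ M) : t ^ α ≤ k ^ |α| * M ^ α := by
  have hk₀ : 0 < k := by linarith
  have ht : 0 < t := (div_pos hM hk₀).trans_le h₁
  rcases le_total 0 α with hα | hα
  · exact (rpow_le_rpow ht.le h₂ hα).trans
      (le_mul_of_one_le_left (rpow_nonneg hM.le α) (one_le_rpow hk (abs_nonneg α)))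
  · calc t ^ α ≤ (M / k) ^ α := rpow_le_rpow_of_nonpos (div_pos hM hk₀) h₁ hα
      _ = k ^ |α| * M ^ α := by
        rw [div_rpow hM.le hk₀.le, abs_of_nonpos hα, rpow_neg hk₀.le]
        field_simp

lemma rpow_neg_abs_mul_le_rpow_of_div_le {k M t : ℝ} (α : ℝ) (hk : 1 ≤ k) (hM : 0 < M)
    (h₁ : M / k ≤ t) (h₂ : t ≤ M) : k ^ (-|α|) * M ^ α ≤ t ^ α := by
  have hk₀ : 0 < k := by linarith
  have ht : 0 < t := (div_pos hM hk₀).trans_le h₁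
  have h := rpow_le_rpow_abs_mul_of_div_le (-α) hk hM h₁ h₂
  rw [abs_neg, rpow_neg ht.le, rpow_neg hM.le, ← div_eq_mul_inv,
    inv_le_comm₀ (by positivity) (by positivity), inv_div] at h
  rwa [rpow_neg hk₀.le, inv_mul_eq_div]

lemma rpow_min_mul_rpow_add_le {a R s : ℝ} (α : ℝ) (ha : 0 ≤ a) (hR : 0 < R) (hs : 1 ≤ s) :
    s ^ min α 0 * (a + R) ^ α ≤ (a + s * R) ^ α := by
  have hs₀ : 0 < s := by linarith
  have hRs : R ≤ s * R := le_mul_of_one_le_left hR.le hs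
  rcases le_total 0 α with hα | hα
  · rw [min_eq_right hα, rpow_zero, one_mul]
    exact rpow_le_rpow (by positivity) (by linarith) hα
  · rw [min_eq_left hα, ← mul_rpow hs₀.le (by positivity)]
    exact rpow_le_rpow_of_nonpos (by positivity)
      (by nlinarith [le_mul_of_one_le_left ha hs]) hα

lemma exists_dist_le_norm_add_le {E : Type*} [NormedAddCommGroup E] [NormedSpace ℝ E]
    [Nontrivial E] (x : E) {r : ℝ} (hr : 0 ≤ r) : ∃ z : E, dist z x ≤ r ∧ ‖x‖ + r ≤ ‖z‖ := by
  rcases eq_or_ne x 0 with rfl | hx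
  · obtain ⟨z, hz⟩ := exists_norm_eq E hr
    exact ⟨z, by simp [hz], by simp [hz]⟩
  · have hx' : 0 < ‖x‖ := norm_pos_iff.2 hx
    refine ⟨x + (r / ‖x‖) • x, ?_, ?_⟩
    · rw [dist_eq_norm, add_sub_cancel_left, norm_smul, norm_of_nonneg (by positivity)]
      exact (div_mul_cancel₀ r hx'.ne').le
    · rw [show x + (r / ‖x‖) • x = (1 + r / ‖x‖) • x by rw [add_smul, one_smul], norm_smul,
        norm_of_nonneg (by positivity), add_mul, one_mul, div_mul_cancel₀ r hx'.ne']

variable {E : Type*} [NormedAddCommGroup E] [NormedSpace ℝ E] [FiniteDimensional ℝ E]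
  [MeasurableSpace E] [BorelSpace E] (ν : Measure E) [ν.IsAddHaarMeasure]

lemma measureReal_ball_eq_pow_mul (x : E) {R : ℝ} (hR : 0 < R) :
    ν.real (ball x R) = R ^ finrank ℝ E * ν.real (ball (0 : E) 1) := by
  rw [measureReal_def, Measure.addHaar_ball_of_pos ν x hR, ENNReal.toReal_mul,
    ENNReal.toReal_ofReal (by positivity), measureReal_def]

lemma setIntegral_ball_zero_norm_rpow {R : ℝ} (hR : 0 < R) (r α : ℝ) :
    ∫ y in ball (0 : E) (R * r), ‖y‖ ^ α ∂ν
      = R ^ finrank ℝ E * (R ^ α * ∫ y in ball (0 : E) r, ‖y‖ ^ α ∂ν) := by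
  have h := Measure.setIntegral_comp_smul_of_pos ν (fun y : E ↦ ‖y‖ ^ α) (ball (0 : E) r) hR
  rw [_root_.smul_ball hR.ne', smul_zero, norm_of_nonneg hR.le, smul_eq_mul] at h
  simp_rw [norm_smul, norm_of_nonneg hR.le, mul_rpow hR.le (norm_nonneg _)] at h
  rw [integral_const_mul] at h
  rw [h, mul_inv_cancel_left₀ (by positivity)]

variable [Nontrivial E]

lemma integrableOn_ball_norm_rpow {α : ℝ} (hα : -(finrank ℝ E : ℝ) < α) (x : E) (R : ℝ) :
    IntegrableOn (fun y : E ↦ ‖y‖ ^ α) (ball x R) ν := by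
  have h : LocallyIntegrable (fun y : E ↦ ‖y‖ ^ α) ν := by
    refine locallyIntegrable_of_norm_le_rpow (C := 1) (α := -α) finrank_pos (by linarith)
      (ae_of_all _ fun y ↦ ?_) (measurable_norm.pow_const α).aestronglyMeasurable
    rw [norm_of_nonneg (by positivity), neg_neg, one_mul]
  exact (h.integrableOn_isCompact (isCompact_closedBall x R)).mono_set ball_subset_closedBall

lemma exists_le_setIntegral_ball_norm_rpow {α : ℝ} (hα : -(finrank ℝ E : ℝ) < α) :
    ∃ c : ℝ, 0 < c ∧ ∀ (x : E) (R : ℝ), 0 < R →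
      c * (R ^ finrank ℝ E * (‖x‖ + R) ^ α) ≤ ∫ y in ball x R, ‖y‖ ^ α ∂ν := by
  have hv : 0 < ν.real (ball (0 : E) 1) :=
    ENNReal.toReal_pos (measure_ball_pos ν 0 one_pos).ne' measure_ball_lt_top.ne
  refine ⟨4 ^ (-|α|) * (1 / 4) ^ finrank ℝ E * ν.real (ball (0 : E) 1), by positivity,
    fun x R hR ↦ ?_⟩
  obtain ⟨z, hzx, hz⟩ := exists_dist_le_norm_add_le x (half_pos hR).le
  have hsub : ball z (1 / 4 * R) ⊆ ball x R := ball_subset_ball' (by linarith)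
  have hM : 0 < ‖x‖ + R := by positivity
  calc _ = 4 ^ (-|α|) * (‖x‖ + R) ^ α * ν.real (ball z (1 / 4 * R)) := by
        rw [measureReal_ball_eq_pow_mul ν z (by positivity), mul_pow]
        ring
    _ ≤ ∫ y in ball z (1 / 4 * R), ‖y‖ ^ α ∂ν := by
        refine setIntegral_ge_of_const_le_real measurableSet_ball measure_ball_lt_top.ne
          (fun y hy ↦ rpow_neg_abs_mul_le_rpow_of_div_le α (by norm_num) hM ?_ ?_)
          (integrableOn_ball_norm_rpow ν hα z _)
        · have h₁ : dist z y < 1 / 4 * R := mem_ball'.1 hy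
          have h₂ := norm_sub_norm_le z y
          rw [← dist_eq_norm] at h₂
          linarith [norm_nonneg x]
        · have h₁ : dist y x < R := hsub hy
          have h₂ := norm_sub_norm_le y x
          rw [← dist_eq_norm] at h₂
          linarith
    _ ≤ ∫ y in ball x R, ‖y‖ ^ α ∂ν :=
        setIntegral_mono_set (integrableOn_ball_norm_rpow ν hα x R)
          (ae_of_all _ fun y ↦ by positivity) hsub.eventuallyLE

lemma exists_setIntegral_ball_norm_rpow_le {α : ℝ} (hα : -(finrank ℝ E : ℝ) < α) :
    ∃ C : ℝ, 0 < C ∧ ∀ (x : E) (R : ℝ), 0 < R →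
      ∫ y in ball x R, ‖y‖ ^ α ∂ν ≤ C * (R ^ finrank ℝ E * (‖x‖ + R) ^ α) := by
  have hv : 0 < ν.real (ball (0 : E) 1) :=
    ENNReal.toReal_pos (measure_ball_pos ν 0 one_pos).ne' measure_ball_lt_top.ne
  have hK : 0 ≤ ∫ y in ball (0 : E) 3, ‖y‖ ^ α ∂ν := integral_nonneg fun y ↦ by positivity
  set v := ν.real (ball (0 : E) 1)
  set K := ∫ y in ball (0 : E) 3, ‖y‖ ^ α ∂ν
  refine ⟨3 ^ |α| * (v + K), by positivity, fun x R hR ↦ ?_⟩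
  have hM : 0 < ‖x‖ + R := by positivity
  rcases le_total (2 * R) ‖x‖ with hx | hx
  · calc ∫ y in ball x R, ‖y‖ ^ α ∂ν
        ≤ ∫ _ in ball x R, 3 ^ |α| * (‖x‖ + R) ^ α ∂ν := by
          refine setIntegral_mono_on (integrableOn_ball_norm_rpow ν hα x R)
            (integrableOn_const measure_ball_lt_top.ne) measurableSet_ball
            fun y hy ↦ rpow_le_rpow_abs_mul_of_div_le α (by norm_num) hM ?_ ?_
          · have h₁ : dist x y < R := mem_ball'.1 hy
            have h₂ := norm_sub_norm_le x y
            rw [← dist_eq_norm] at h₂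
            linarith
          · have h₁ : dist y x < R := hy
            have h₂ := norm_sub_norm_le y x
            rw [← dist_eq_norm] at h₂
            linarith
      _ = 3 ^ |α| * v * (R ^ finrank ℝ E * (‖x‖ + R) ^ α) := by
          rw [setIntegral_const, measureReal_ball_eq_pow_mul ν x hR, smul_eq_mul]
          ring
      _ ≤ 3 ^ |α| * (v + K) * (R ^ finrank ℝ E * (‖x‖ + R) ^ α) := by
          gcongr
          exact le_add_of_nonneg_right hK
  · calc ∫ y in ball x R, ‖y‖ ^ α ∂ν
        ≤ ∫ y in ball (0 : E) (R * 3), ‖y‖ ^ α ∂ν :=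
          setIntegral_mono_set (integrableOn_ball_norm_rpow ν hα 0 _)
            (ae_of_all _ fun y ↦ by positivity)
            (ball_subset_ball' (by rw [dist_zero_right]; linarith)).eventuallyLE
      _ = R ^ finrank ℝ E * (R ^ α * K) := setIntegral_ball_zero_norm_rpow ν hR 3 α
      _ ≤ R ^ finrank ℝ E * (3 ^ |α| * (‖x‖ + R) ^ α * (v + K)) := by
          gcongr
          · exact rpow_le_rpow_abs_mul_of_div_le α (by norm_num) hM (by linarith)
              (by linarith [norm_nonneg x])
          · exact le_add_of_nonneg_left hv.le
      _ = 3 ^ |α| * (v + K) * (R ^ finrank ℝ E * (‖x‖ + R) ^ α) := by ring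

theorem exists_reverse_doubling_norm_rpow {α : ℝ} (hα : -(finrank ℝ E : ℝ) < α) :
    ∃ C : ℝ, 0 < C ∧ ∀ (x : E) (R s : ℝ), 0 < R → 1 ≤ s →
      C * s ^ (finrank ℝ E + min α 0) * ∫ y in ball x R, ‖y‖ ^ α ∂ν
        ≤ ∫ y in ball x (s * R), ‖y‖ ^ α ∂ν := by
  obtain ⟨c, hc, hlower⟩ := exists_le_setIntegral_ball_norm_rpow ν hα
  obtain ⟨C, hC, hupper⟩ := exists_setIntegral_ball_norm_rpow_le ν hα
  refine ⟨c / C, by positivity, fun x R s hR hs ↦ ?_⟩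
  have hs₀ : 0 < s := by linarith
  calc c / C * s ^ (finrank ℝ E + min α 0) * ∫ y in ball x R, ‖y‖ ^ α ∂ν
      ≤ c / C * s ^ (finrank ℝ E + min α 0) * (C * (R ^ finrank ℝ E * (‖x‖ + R) ^ α)) := by
        gcongr
        exact hupper x R hR
    _ = c * ((s * R) ^ finrank ℝ E * (s ^ min α 0 * (‖x‖ + R) ^ α)) := by
        rw [rpow_add hs₀, rpow_natCast, mul_pow]
        field_simp
    _ ≤ c * ((s * R) ^ finrank ℝ E * (‖x‖ + s * R) ^ α) := by
        gcongr
        exact rpow_min_mul_rpow_add_le α (norm_nonneg x) hR hs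
    _ ≤ ∫ y in ball x (s * R), ‖y‖ ^ α ∂ν := hlower x _ (by positivity)

end RadialPowerWeight

/-- Reverse doubling of order `μ = 1 - max(b,0)/2 > 1/2` for `w^{-N/2}` with
`w(y) = |y|^b`, `-N < b < 1`. -/
theorem reverse_doubling_radial_weight
    (N : ℕ) (hN : 1 ≤ N) (b : ℝ) (hb1 : -(N : ℝ) < b) (hb2 : b < 1)
    (μ : ℝ) (hμ : μ = 1 - max b 0 / 2) :
    1 / 2 < μ ∧
    ∃ C : ℝ, 0 < C ∧ ∀ x : EuclideanSpace ℝ (Fin N), ∀ R s : ℝ, 0 < R → 1 ≤ s →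
      C * s ^ (μ * N) * ∫ y in Metric.ball x R, ‖y‖ ^ (-(b * N) / 2) ≤
        ∫ y in Metric.ball x (s * R), ‖y‖ ^ (-(b * N) / 2) := by
  have hN₀ : (0 : ℝ) < N := by exact_mod_cast hN
  have : Nonempty (Fin N) := ⟨⟨0, hN⟩⟩
  have hexp : μ * N = N + min (-(b * N) / 2) 0 := by
    rcases le_total b 0 with hb | hb
    · rw [hμ, max_eq_right hb, min_eq_right (by nlinarith)]
      ring
    · rw [hμ, max_eq_left hb, min_eq_left (by nlinarith)]
      ring
  refine ⟨?_, ?_⟩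
  · have : max b 0 < 1 := max_lt hb2 one_pos
    linarith
  · rw [hexp]
    simpa only [finrank_euclideanSpace_fin] using
      exists_reverse_doubling_norm_rpow (volume : Measure (EuclideanSpace ℝ (Fin N)))
        (α := -(b * N) / 2) (by rw [finrank_euclideanSpace_fin]; nlinarith)
end
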